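/- Let U ⊆ ℝ² be open and φ : U → ℝ³ a smooth map with Q(φ(u,v)) ≠ 0 for all (u,v) ∈ U, and set ψ = φ/Q(φ). With E, F, G, l̄, m̄, n̄ defined for a smooth map χ : U → ℝ³ by E = B(χ_u,χ_u), F = B(χ_u,χ_v), G = B(χ_v,χ_v), l̄ = det(χ_u,χ_v,χ_uu), m̄ = det(χ_u,χ_v,χ_uv), n̄ = det(χ_u,χ_v,χ_vv), the discriminant δ̃ = (E n̄ − G l̄)² − 4(F n̄ − G m̄)(E m̄ − F l̄) transforms by δ̃(ψ) = δ̃(φ)/Q(φ)¹⁰; in particular δ̃(ψ)(u,v) = 0 if and only if δ̃(φ)(u,v) = 0 (the Möbius inversion preserves the Lightlike Principal Locus). -/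

import Mathlib

noncomputable section

/-- The Minkowski bilinear form on `ℝ³`. -/
def B (p q : EuclideanSpace ℝ (Fin 3)) : ℝ := p 0 * q 0 + p 1 * q 1 - p 2 * q 2

/-- The Minkowski quadratic form. -/
def Q (p : EuclideanSpace ℝ (Fin 3)) : ℝ := B p p

/-- The Möbius inversion `i_M(p) = p / Q(p)`. -/
def iM (p : EuclideanSpace ℝ (Fin 3)) : EuclideanSpace ℝ (Fin 3) := (Q p)⁻¹ • p

/-- Partial derivative with respect to the first variable. -/
def pdu (χ : ℝ × ℝ → EuclideanSpace ℝ (Fin 3)) (x : ℝ × ℝ) : EuclideanSpace ℝ (Fin 3) :=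
  fderiv ℝ χ x (1, 0)

/-- Partial derivative with respect to the second variable. -/
def pdv (χ : ℝ × ℝ → EuclideanSpace ℝ (Fin 3)) (x : ℝ × ℝ) : EuclideanSpace ℝ (Fin 3) :=
  fderiv ℝ χ x (0, 1)

/-- The determinant of the 3×3 matrix with the given columns. -/
def det3 (u v w : EuclideanSpace ℝ (Fin 3)) : ℝ :=
  Matrix.det !![u 0, v 0, w 0; u 1, v 1, w 1; u 2, v 2, w 2]

/-- First fundamental form coefficient `E`. -/
def Ec (χ : ℝ × ℝ → EuclideanSpace ℝ (Fin 3)) (x : ℝ × ℝ) : ℝ := B (pdu χ x) (pdu χ x)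

/-- First fundamental form coefficient `F`. -/
def Fc (χ : ℝ × ℝ → EuclideanSpace ℝ (Fin 3)) (x : ℝ × ℝ) : ℝ := B (pdu χ x) (pdv χ x)

/-- First fundamental form coefficient `G`. -/
def Gc (χ : ℝ × ℝ → EuclideanSpace ℝ (Fin 3)) (x : ℝ × ℝ) : ℝ := B (pdv χ x) (pdv χ x)

/-- Second fundamental form coefficient `l̄ = det(χ_u, χ_v, χ_uu)`. -/
def lb (χ : ℝ × ℝ → EuclideanSpace ℝ (Fin 3)) (x : ℝ × ℝ) : ℝ :=
  det3 (pdu χ x) (pdv χ x) (pdu (pdu χ) x)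

/-- Second fundamental form coefficient `m̄ = det(χ_u, χ_v, χ_uv)`. -/
def mb (χ : ℝ × ℝ → EuclideanSpace ℝ (Fin 3)) (x : ℝ × ℝ) : ℝ :=
  det3 (pdu χ x) (pdv χ x) (pdv (pdu χ) x)

/-- Second fundamental form coefficient `n̄ = det(χ_u, χ_v, χ_vv)`. -/
def nb (χ : ℝ × ℝ → EuclideanSpace ℝ (Fin 3)) (x : ℝ × ℝ) : ℝ :=
  det3 (pdu χ x) (pdv χ x) (pdv (pdv χ) x)

/-- The discriminant of the BDE of the lines of principal curvature. -/
def disc (χ : ℝ × ℝ → EuclideanSpace ℝ (Fin 3)) (x : ℝ × ℝ) : ℝ :=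
  (Ec χ x * nb χ x - Gc χ x * lb χ x) ^ 2 -
    4 * (Fc χ x * nb χ x - Gc χ x * mb χ x) * (Ec χ x * mb χ x - Fc χ x * lb χ x)

lemma hasFDerivAt_coord {f : ℝ × ℝ → EuclideanSpace ℝ (Fin 3)} {x : ℝ × ℝ}
    (hf : DifferentiableAt ℝ f x) (i : Fin 3) :
    HasFDerivAt (fun y => f y i)
      ((EuclideanSpace.proj i : EuclideanSpace ℝ (Fin 3) →L[ℝ] ℝ).comp (fderiv ℝ f x)) x :=
  (EuclideanSpace.proj i : EuclideanSpace ℝ (Fin 3) →L[ℝ] ℝ).hasFDerivAt.comp x hf.hasFDerivAt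

lemma differentiableAt_B {f g : ℝ × ℝ → EuclideanSpace ℝ (Fin 3)} {x : ℝ × ℝ}
    (hf : DifferentiableAt ℝ f x) (hg : DifferentiableAt ℝ g x) :
    DifferentiableAt ℝ (fun y => B (f y) (g y)) x := by
  have hf' i := (hasFDerivAt_coord hf i).differentiableAt
  have hg' i := (hasFDerivAt_coord hg i).differentiableAt
  exact (((hf' 0).mul (hg' 0)).add ((hf' 1).mul (hg' 1))).sub ((hf' 2).mul (hg' 2))

lemma fderiv_B {f g : ℝ × ℝ → EuclideanSpace ℝ (Fin 3)} {x : ℝ × ℝ}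
    (hf : DifferentiableAt ℝ f x) (hg : DifferentiableAt ℝ g x) (a : ℝ × ℝ) :
    fderiv ℝ (fun y => B (f y) (g y)) x a
      = B (fderiv ℝ f x a) (g x) + B (f x) (fderiv ℝ g x a) := by
  have hf' i := hasFDerivAt_coord hf i
  have hg' i := hasFDerivAt_coord hg i
  have h := (((hf' 0).mul (hg' 0)).add ((hf' 1).mul (hg' 1))).sub ((hf' 2).mul (hg' 2))
  refine (congrArg (fun L : ℝ × ℝ →L[ℝ] ℝ => L a) h.fderiv).trans ?_
  simp [B]
  ring

lemma B_comm (p q : EuclideanSpace ℝ (Fin 3)) : B p q = B q p := by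
  simp only [B]; ring

lemma differentiableAt_inv_Q {φ : ℝ × ℝ → EuclideanSpace ℝ (Fin 3)} {x : ℝ × ℝ}
    (hφ : DifferentiableAt ℝ φ x) (hQ : Q (φ x) ≠ 0) :
    DifferentiableAt ℝ (fun y => (Q (φ y))⁻¹) x :=
  (differentiableAt_B hφ hφ).fun_inv hQ

lemma fderiv_inv_Q {φ : ℝ × ℝ → EuclideanSpace ℝ (Fin 3)} {x : ℝ × ℝ}
    (hφ : DifferentiableAt ℝ φ x) (hQ : Q (φ x) ≠ 0) (a : ℝ × ℝ) :
    fderiv ℝ (fun y => (Q (φ y))⁻¹) x a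
      = -2 * (Q (φ x))⁻¹ ^ 2 * B (φ x) (fderiv ℝ φ x a) := by
  have hd : DifferentiableAt ℝ (fun y => Q (φ y)) x := differentiableAt_B hφ hφ
  have h := (hasDerivAt_inv hQ).comp_hasFDerivAt x hd.hasFDerivAt
  have h2 : fderiv ℝ (fun y => Q (φ y)) x a = _ := fderiv_B hφ hφ a
  refine (congrArg (fun L : ℝ × ℝ →L[ℝ] ℝ => L a) h.fderiv).trans ?_
  simp only [smul_apply, h2, smul_eq_mul]
  rw [B_comm (fderiv ℝ φ x a)]
  field_simp
  ring

lemma fderiv_iM_comp {φ : ℝ × ℝ → EuclideanSpace ℝ (Fin 3)} {x : ℝ × ℝ}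
    (hφ : DifferentiableAt ℝ φ x) (hQ : Q (φ x) ≠ 0) (a : ℝ × ℝ) :
    fderiv ℝ (fun y => iM (φ y)) x a
      = (Q (φ x))⁻¹ • fderiv ℝ φ x a
        - (2 * (Q (φ x))⁻¹ ^ 2 * B (φ x) (fderiv ℝ φ x a)) • φ x := by
  have h := (differentiableAt_inv_Q hφ hQ).hasFDerivAt.fun_smul hφ.hasFDerivAt
  refine (congrArg (fun L : ℝ × ℝ →L[ℝ] EuclideanSpace ℝ (Fin 3) => L a) h.fderiv).trans ?_
  simp only [add_apply, smul_apply,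
    ContinuousLinearMap.smulRight_apply, fderiv_inv_Q hφ hQ]
  module

lemma fderiv_fderiv_iM_comp {φ : ℝ × ℝ → EuclideanSpace ℝ (Fin 3)} {x : ℝ × ℝ}
    (hφ : ContDiffAt ℝ 2 φ x) (hQ : Q (φ x) ≠ 0) (a b : ℝ × ℝ) :
    fderiv ℝ (fun y => fderiv ℝ (fun z => iM (φ z)) y b) x a
      = (Q (φ x))⁻¹ • fderiv ℝ (fun y => fderiv ℝ φ y b) x a
        - (2 * (Q (φ x))⁻¹ ^ 2 * B (φ x) (fderiv ℝ φ x a)) • fderiv ℝ φ x b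
        - (2 * (Q (φ x))⁻¹ ^ 2 * B (φ x) (fderiv ℝ φ x b)) • fderiv ℝ φ x a
        - (2 * (Q (φ x))⁻¹ ^ 2 * (B (fderiv ℝ φ x a) (fderiv ℝ φ x b)
              + B (φ x) (fderiv ℝ (fun y => fderiv ℝ φ y b) x a))
            - 8 * (Q (φ x))⁻¹ ^ 3 * B (φ x) (fderiv ℝ φ x a) * B (φ x) (fderiv ℝ φ x b))
          • φ x := by
  have hd : DifferentiableAt ℝ φ x := hφ.differentiableAt (by norm_num)
  have hdb : DifferentiableAt ℝ (fun y => fderiv ℝ φ y b) x :=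
    ((hφ.fderiv_right (m := 1) (by norm_num)).differentiableAt (by norm_num)).clm_apply
      (differentiableAt_const b)
  have hev : (fun y => fderiv ℝ (fun z => iM (φ z)) y b) =ᶠ[nhds x] fun y =>
      (Q (φ y))⁻¹ • fderiv ℝ φ y b
        - (2 * (Q (φ y))⁻¹ ^ 2 * B (φ y) (fderiv ℝ φ y b)) • φ y := by
    have hQc : ContinuousAt (fun y => Q (φ y)) x := (differentiableAt_B hd hd).continuousAt
    filter_upwards [hφ.eventually (by simp), hQc.eventually_ne hQ] with y hy hQy
    exact fderiv_iM_comp (hy.differentiableAt (by norm_num)) hQy b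
  have hr := differentiableAt_inv_Q hd hQ
  have hB := differentiableAt_B hd hdb
  have hr2 : HasFDerivAt (fun y => (Q (φ y))⁻¹ ^ 2) _ x := hr.hasFDerivAt.pow 2
  have h := (hr.hasFDerivAt.fun_smul hdb.hasFDerivAt).fun_sub
    (((hr2.const_mul 2).fun_mul hB.hasFDerivAt).fun_smul hd.hasFDerivAt)
  rw [hev.fderiv_eq, h.fderiv]
  simp only [add_apply, sub_apply,
    smul_apply, ContinuousLinearMap.smulRight_apply, fderiv_inv_Q hd hQ,
    fderiv_B hd hdb, smul_eq_mul, nsmul_eq_mul]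
  push_cast
  module

lemma B_reflect (p a b : EuclideanSpace ℝ (Fin 3)) (hQ : Q p ≠ 0) :
    B ((Q p)⁻¹ • a - (2 * (Q p)⁻¹ ^ 2 * B p a) • p) ((Q p)⁻¹ • b - (2 * (Q p)⁻¹ ^ 2 * B p b) • p)
      = B a b / Q p ^ 2 := by
  have h : ∀ r s t : ℝ, B (r • a - s • p) (r • b - t • p)
      = r ^ 2 * B a b - r * t * B p a - r * s * B p b + s * t * Q p := by
    intro r s t
    simp [B, Q]
    ring
  rw [h]
  field_simp
  ring

lemma B_cramer (p a b c : EuclideanSpace ℝ (Fin 3)) :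
    B p a * det3 p b c + B p b * det3 a p c + B p c * det3 a b p = Q p * det3 a b c := by
  simp [B, Q, det3, Matrix.det_fin_three]
  ring

lemma det3_reflect (p a b c : EuclideanSpace ℝ (Fin 3)) (hQ : Q p ≠ 0) (e k l : ℝ) :
    det3 ((Q p)⁻¹ • a - (2 * (Q p)⁻¹ ^ 2 * B p a) • p)
        ((Q p)⁻¹ • b - (2 * (Q p)⁻¹ ^ 2 * B p b) • p)
        ((Q p)⁻¹ • c - k • a - l • b - (2 * (Q p)⁻¹ ^ 2 * (e + B p c)
          - 2 * (Q p)⁻¹ * (k * B p a + l * B p b)) • p)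
      = -(det3 a b c + 2 * e / Q p * det3 a b p) / Q p ^ 3 := by
  have h : ∀ r s t m : ℝ, det3 (r • a - s • p) (r • b - t • p) (r • c - k • a - l • b - m • p)
      = r ^ 3 * det3 a b c - r ^ 2 * s * det3 p b c - r ^ 2 * t * det3 a p c
        - (r ^ 2 * m + r * s * k + r * t * l) * det3 a b p := by
    intro r s t m
    simp [det3, Matrix.det_fin_three]
    ring
  rw [h]
  have hc := B_cramer p a b c
  field_simp
  linear_combination (-2 : ℝ) * hc

lemma det3_fderiv_iM_comp {φ : ℝ × ℝ → EuclideanSpace ℝ (Fin 3)} {x : ℝ × ℝ}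
    (hφ : ContDiffAt ℝ 2 φ x) (hQ : Q (φ x) ≠ 0) (u v a b : ℝ × ℝ) (k₁ k₂ l₁ l₂ : ℝ)
    (ha : a = k₁ • u + l₁ • v) (hb : b = k₂ • u + l₂ • v) :
    det3 (fderiv ℝ (fun z => iM (φ z)) x u) (fderiv ℝ (fun z => iM (φ z)) x v)
        (fderiv ℝ (fun y => fderiv ℝ (fun z => iM (φ z)) y b) x a)
      = -(det3 (fderiv ℝ φ x u) (fderiv ℝ φ x v) (fderiv ℝ (fun y => fderiv ℝ φ y b) x a)
          + 2 * B (fderiv ℝ φ x a) (fderiv ℝ φ x b) / Q (φ x)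
            * det3 (fderiv ℝ φ x u) (fderiv ℝ φ x v) (φ x)) / Q (φ x) ^ 3 := by
  have hd : DifferentiableAt ℝ φ x := hφ.differentiableAt (by norm_num)
  have hlin : ∀ p q r : EuclideanSpace ℝ (Fin 3), ∀ k l : ℝ,
      B p (k • q + l • r) = k * B p q + l * B p r := by
    intro p q r k l
    simp [B]
    ring
  rw [fderiv_iM_comp hd hQ, fderiv_iM_comp hd hQ, fderiv_fderiv_iM_comp hφ hQ,
    ← det3_reflect (φ x) _ _ _ hQ _
      (2 * (Q (φ x))⁻¹ ^ 2 * (k₂ * B (φ x) (fderiv ℝ φ x a) + k₁ * B (φ x) (fderiv ℝ φ x b)))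
      (2 * (Q (φ x))⁻¹ ^ 2 * (l₂ * B (φ x) (fderiv ℝ φ x a) + l₁ * B (φ x) (fderiv ℝ φ x b)))]
  have ha' : fderiv ℝ φ x a = k₁ • fderiv ℝ φ x u + l₁ • fderiv ℝ φ x v := by simp [ha]
  have hb' : fderiv ℝ φ x b = k₂ • fderiv ℝ φ x u + l₂ • fderiv ℝ φ x v := by simp [hb]
  congr 1
  generalize fderiv ℝ (fun y => fderiv ℝ φ y b) x a = c
  rw [ha', hb', hlin, hlin]
  module

theorem stmt_10 (U : Set (ℝ × ℝ)) (hU : IsOpen U)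
    (φ ψ : ℝ × ℝ → EuclideanSpace ℝ (Fin 3))
    (hφ : ContDiffOn ℝ (⊤ : ℕ∞) φ U) (hQ : ∀ x ∈ U, Q (φ x) ≠ 0)
    (hψ : ∀ x, ψ x = iM (φ x)) (x : ℝ × ℝ) (hx : x ∈ U) :
    disc ψ x = disc φ x / Q (φ x) ^ 10 ∧ (disc ψ x = 0 ↔ disc φ x = 0) := by
  obtain rfl : ψ = fun y => iM (φ y) := funext hψ
  have hφx : ContDiffAt ℝ 2 φ x :=
    (hφ.contDiffAt (hU.mem_nhds hx)).of_le (WithTop.coe_le_coe.2 (le_top : (2 : ℕ∞) ≤ ⊤))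
  have hd : DifferentiableAt ℝ φ x := hφx.differentiableAt (by norm_num)
  have hq := hQ x hx
  have hI : ∀ a b : ℝ × ℝ, B (fderiv ℝ (fun y => iM (φ y)) x a) (fderiv ℝ (fun y => iM (φ y)) x b)
      = B (fderiv ℝ φ x a) (fderiv ℝ φ x b) / Q (φ x) ^ 2 := by
    intro a b
    rw [fderiv_iM_comp hd hq, fderiv_iM_comp hd hq, B_reflect _ _ _ hq]
  have hl := det3_fderiv_iM_comp hφx hq (1, 0) (0, 1) (1, 0) (1, 0) 1 1 0 0 (by simp) (by simp)
  have hm := det3_fderiv_iM_comp hφx hq (1, 0) (0, 1) (0, 1) (1, 0) 0 1 1 0 (by simp) (by simp)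
  have hn := det3_fderiv_iM_comp hφx hq (1, 0) (0, 1) (0, 1) (0, 1) 0 0 1 1 (by simp) (by simp)
  rw [B_comm (fderiv ℝ φ x (0, 1)) (fderiv ℝ φ x (1, 0))] at hm
  have key : disc (fun y => iM (φ y)) x = disc φ x / Q (φ x) ^ 10 := by
    unfold disc Ec Fc Gc lb mb nb pdu pdv
    rw [hI, hI, hI, hl, hm, hn]
    field_simp
    ring
  exact ⟨key, by simp [key, hq]⟩
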